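/- arXiv:1602.01085 — 2 statements merged into one kernel-verified Lean document; each statement's English description precedes it below -/
import Mathlib

section
/- Fix an integer m ≥ 2 and x ∈ ℝ with 0 < x < 1. Then for every natural number n, as q → 1⁻ (with q ∈ (0,1)), ψ_q^{(m)}(x) − (−1)^m·ψ_q^{(m)}(1−x) − ( ψ^{(m)}(x) − (−1)^m·ψ^{(m)}(1−x) ) = O((1−q)^n). -/
open Filter Topology Asymptotics Real

/-- The q-polygamma function
`ψ_q^{(m)}(x) = (log q)^{m+1} ∑_{k≥1} k^m q^{kx}/(1-q^k)`. -/
noncomputable def qPolygamma (q : ℝ) (m : ℕ) (x : ℝ) : ℝ :=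
  (Real.log q) ^ (m + 1) *
    ∑' k : ℕ, ((k : ℝ) + 1) ^ m * q ^ (((k : ℝ) + 1) * x) / (1 - q ^ (k + 1))

/-- The classical polygamma function `ψ^{(m)}(x)`, the `m`-th derivative of the digamma
function, i.e. the `(m+1)`-st derivative of `log ∘ Γ`. -/
noncomputable def polygamma (m : ℕ) (x : ℝ) : ℝ :=
  iteratedDeriv (m + 1) (fun y : ℝ => Real.log (Real.Gamma y)) x


lemma int_abs_bound (x : ℝ) (hx0 : 0 < x) (hx1 : x < 1) (j : ℤ) :
    (1 - x) * |(j:ℝ)| ≤ |x + j| := by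
  rcases le_or_gt 0 j with h | h
  · have : (0:ℝ) ≤ j := by exact_mod_cast h
    rw [abs_of_nonneg this, abs_of_nonneg (by linarith)]
    nlinarith
  · have : (j:ℝ) ≤ -1 := by exact_mod_cast (by omega : j ≤ -1)
    rw [abs_of_nonpos (by linarith), abs_of_nonpos (by linarith)]
    nlinarith

lemma add_int_ne (x : ℝ) (hx0 : 0 < x) (hx1 : x < 1) (j : ℤ) : x + j ≠ 0 := by
  intro h
  have h1 : (-1:ℝ) < j := by linarith
  have h2 : (j:ℝ) < 0 := by linarith
  have h1' : (-1:ℤ) < j := by exact_mod_cast h1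
  have h2' : j < (0:ℤ) := by exact_mod_cast h2
  omega

lemma mem_compl_int (x : ℝ) (hx0 : 0 < x) (hx1 : x < 1) : (x:ℂ) ∈ Complex.integerComplement := by
  rintro ⟨n, hn⟩
  have : (n:ℝ) = x := by exact_mod_cast hn
  apply add_int_ne x hx0 hx1 (-n)
  push_cast; linarith

lemma cot_analytic (z : ℂ) (hz : z ∈ Complex.integerComplement) :
    AnalyticAt ℂ (fun z : ℂ => (π:ℂ) * Complex.cot (π * z)) z := by
  have h := sin_pi_mul_ne_zero hz
  unfold Complex.cot
  exact analyticAt_const.mul (AnalyticAt.div (by fun_prop) (by fun_prop) h)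

lemma analyticAt_iteratedDeriv {g : ℂ → ℂ} {z : ℂ} (h : AnalyticAt ℂ g z) (k : ℕ) :
    AnalyticAt ℂ (iteratedDeriv k g) z := by
  rw [iteratedDeriv_eq_iterate]
  exact h.iterated_deriv k

lemma summable_row (x : ℝ) (m : ℕ) (hm : 2 ≤ m) :
    Summable fun n : ℤ => 1 / ((x:ℂ) + n) ^ (m + 1) := by
  have := EisensteinSeries.linear_right_summable (x:ℂ) 1 (k := (m+1 : ℕ)) (by push_cast; omega)
  simpa only [Int.cast_one, one_mul, zpow_natCast, one_div] using this

lemma cot_line (m : ℕ) (hm : 2 ≤ m) (x : ℝ) (hx0 : 0 < x) (hx1 : x < 1) :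
    iteratedDeriv m (fun z : ℂ => (π:ℂ) * Complex.cot (π * z)) x =
      (-1) ^ m * (m.factorial : ℂ) * ∑' n : ℤ, 1 / ((x:ℂ) + n) ^ (m + 1) := by
  have hc : ContinuousAt (iteratedDeriv m (fun z : ℂ => (π:ℂ) * Complex.cot (π * z))) x :=
    (analyticAt_iteratedDeriv (cot_analytic x (mem_compl_int x hx0 hx1)) m).continuousAt
  have hpath : Tendsto (fun y : ℝ => (x:ℂ) + y * Complex.I) (𝓝[>] 0) (𝓝 (x:ℂ)) := by
    have : Continuous (fun y : ℝ => (x:ℂ) + y * Complex.I) := by fun_prop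
    have h := (this.tendsto 0).mono_left (nhdsWithin_le_nhds (s := Set.Ioi 0))
    simpa using h
  have h1 := hc.tendsto.comp hpath
  have h2 : Tendsto (fun y : ℝ => (-1) ^ m * (m.factorial : ℂ) *
      ∑' n : ℤ, 1 / ((x:ℂ) + y * Complex.I + n) ^ (m + 1)) (𝓝[>] 0)
      (𝓝 ((-1) ^ m * (m.factorial : ℂ) * ∑' n : ℤ, 1 / ((x:ℂ) + n) ^ (m + 1))) := by
    apply Tendsto.const_mul
    apply tendsto_tsum_of_dominated_convergence (summable_row x m hm).norm
    · intro n
      have hne : (x:ℂ) + n ≠ 0 := by exact_mod_cast add_int_ne x hx0 hx1 n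
      have := hpath.add_const (n:ℂ)
      exact Tendsto.div tendsto_const_nhds (this.pow (m+1)) (pow_ne_zero _ hne)
    · filter_upwards with y n
      have hne : (x:ℂ) + n ≠ 0 := by exact_mod_cast add_int_ne x hx0 hx1 n
      rw [norm_div, norm_div, norm_pow, norm_pow]
      have hle : ‖(x:ℂ) + n‖ ≤ ‖(x:ℂ) + y * Complex.I + n‖ := by
        have := Complex.abs_re_le_norm ((x:ℂ) + y * Complex.I + n)
        have e : (x:ℂ) + n = ((x + n : ℝ) : ℂ) := by push_cast; ring
        rw [e, Complex.norm_real]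
        simpa using this
      have : 0 < ‖(x:ℂ) + n‖ := norm_pos_iff.mpr hne
      gcongr
  refine tendsto_nhds_unique (h1.congr' ?_) h2
  filter_upwards [self_mem_nhdsWithin] with y hy
  have hz : (x:ℂ) + y * Complex.I ∈ UpperHalfPlane.upperHalfPlaneSet := by
    simpa [UpperHalfPlane.upperHalfPlaneSet] using hy
  rw [← iteratedDerivWithin_cot_pi_mul_eq_mul_tsum_div_pow (by omega) hz]
  exact (iteratedDerivWithin_of_isOpen UpperHalfPlane.isOpen_upperHalfPlaneSet hz).symm

lemma real_iteratedDeriv (f : ℝ → ℝ) (g : ℂ → ℂ)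
    (hg : ∀ x ∈ Set.Ioo (0:ℝ) 1, AnalyticAt ℂ g x)
    (hfg : ∀ x ∈ Set.Ioo (0:ℝ) 1, f x = (g x).re) (k : ℕ) :
    ∀ x ∈ Set.Ioo (0:ℝ) 1, iteratedDeriv k f x = (iteratedDeriv k g x).re := by
  induction k with
  | zero => simpa using hfg
  | succ k ih =>
    intro x hx
    rw [iteratedDeriv_succ, iteratedDeriv_succ]
    have h1 := ((analyticAt_iteratedDeriv (hg x hx) k).differentiableAt).hasDerivAt.real_of_complex
    have h2 : iteratedDeriv k f =ᶠ[𝓝 x] fun y : ℝ => (iteratedDeriv k g y).re := by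
      filter_upwards [Ioo_mem_nhds hx.1 hx.2] with y hy using ih y hy
    rw [h2.deriv_eq, h1.deriv]

lemma logGamma_contDiffAt (n : ℕ) (x : ℝ) (hx : 0 < x) :
    ContDiffAt ℝ n (fun y : ℝ => Real.log (Real.Gamma y)) x := by
  have h0 : ContDiffAt ℂ n Complex.Gamma x := by
    have : AnalyticAt ℂ Complex.Gamma x := by
      have hd : DifferentiableOn ℂ Complex.Gamma {z : ℂ | 0 < z.re} := by
        intro z hz
        refine (Complex.differentiableAt_Gamma z ?_).differentiableWithinAt
        intro m hm
        rw [hm] at hz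
        simp at hz
        have : (0:ℝ) ≤ m := by positivity
        linarith
      exact hd.analyticAt ((isOpen_lt continuous_const Complex.continuous_re).mem_nhds
        (by simpa using hx))
    exact this.contDiffAt
  have h1 : ContDiffAt ℝ n Real.Gamma x := by
    have := h0.real_of_complex
    convert! this using 1
  exact h1.log (Real.Gamma_pos_of_pos hx).ne'

lemma sum_real (x : ℝ) (m : ℕ) : ∑' n : ℤ, 1 / ((x:ℂ) + n) ^ (m + 1) =
    ((∑' n : ℤ, 1 / (x + n) ^ (m + 1) : ℝ) : ℂ) := by
  push_cast; rfl


lemma polygamma_comb (m : ℕ) (hm : 2 ≤ m) (x : ℝ) (hx0 : 0 < x) (hx1 : x < 1) :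
    polygamma m x - (-1) ^ m * polygamma m (1 - x) =
      (-1) ^ (m+1) * (m.factorial : ℝ) * ∑' n : ℤ, 1 / (x + n) ^ (m + 1) := by
  set L := fun y : ℝ => Real.log (Real.Gamma y) with hL
  have e1 : polygamma m x - (-1) ^ m * polygamma m (1 - x) =
      iteratedDeriv (m+1) (fun y => L y + L (1 - y)) x := by
    have hc1 : ContDiffAt ℝ (m+1 : ℕ) L x := logGamma_contDiffAt _ x hx0
    have hc2 : ContDiffAt ℝ (m+1 : ℕ) (fun y => L (1 - y)) x := by
      have : ContDiffAt ℝ (m+1 : ℕ) L (1 - x) := logGamma_contDiffAt _ _ (by linarith)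
      exact ContDiffAt.comp x this (by fun_prop)
    rw [iteratedDeriv_fun_add hc1 hc2, iteratedDeriv_comp_const_sub]
    simp only [polygamma, smul_eq_mul, pow_succ]
    ring
  have hev : (fun y => L y + L (1 - y)) =ᶠ[𝓝 x] fun y => Real.log π - Real.log (Real.sin (π * y)) := by
    filter_upwards [Ioo_mem_nhds hx0 hx1] with y hy
    have hs : 0 < Real.sin (π * y) := Real.sin_pos_of_pos_of_lt_pi (by nlinarith [pi_pos, hy.1])
      (by nlinarith [pi_pos, hy.2])
    rw [hL]
    simp only
    rw [← Real.log_mul (Real.Gamma_pos_of_pos hy.1).ne'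
      (Real.Gamma_pos_of_pos (by linarith [hy.2])).ne', Real.Gamma_mul_Gamma_one_sub,
      Real.log_div pi_ne_zero hs.ne']
  have hd : deriv (fun y => Real.log π - Real.log (Real.sin (π * y))) =ᶠ[𝓝 x]
      fun y : ℝ => -(((π:ℂ) * Complex.cot (π * y)).re) := by
    filter_upwards [Ioo_mem_nhds hx0 hx1] with y hy
    have hs : 0 < Real.sin (π * y) := Real.sin_pos_of_pos_of_lt_pi (by nlinarith [pi_pos, hy.1])
      (by nlinarith [pi_pos, hy.2])
    have h1 : HasDerivAt (fun y => Real.sin (π * y)) (Real.cos (π * y) * π) y := by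
      simpa using ((hasDerivAt_id y).const_mul π).sin
    have h2 := (h1.log hs.ne').const_sub (Real.log π)
    rw [h2.deriv, Complex.cot]
    have : (π:ℂ) * (Complex.cos (π * y) / Complex.sin (π * y)) =
      ((π * (Real.cos (π * y) / Real.sin (π * y)) : ℝ) : ℂ) := by push_cast; rfl
    rw [this, Complex.ofReal_re]
    ring
  rw [e1, hev.iteratedDeriv_eq, iteratedDeriv_succ', hd.iteratedDeriv_eq, iteratedDeriv_fun_neg,
    real_iteratedDeriv _ (fun z : ℂ => (π:ℂ) * Complex.cot (π * z))
      (fun y hy => cot_analytic y (mem_compl_int y hy.1 hy.2)) (fun _ _ => rfl) m x ⟨hx0, hx1⟩,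
    cot_line m hm x hx0 hx1, sum_real]
  have : ((-1) ^ m * (m.factorial : ℂ) * ((∑' n : ℤ, 1 / (x + n) ^ (m + 1) : ℝ) : ℂ)) =
    (((-1) ^ m * (m.factorial : ℝ) * (∑' n : ℤ, 1 / (x + n) ^ (m + 1) : ℝ) : ℝ) : ℂ) := by
    push_cast; rfl
  rw [this, Complex.ofReal_re, pow_succ]
  ring
/-- The summand of the double series. -/
noncomputable def dblT (m : ℕ) (x c : ℝ) (p : ℤ × ℤ) : ℂ :=
  1 / ((x:ℂ) + p.1 + p.2 * (c * Complex.I)) ^ (m + 1)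

lemma dblT_summable (m : ℕ) (hm : 2 ≤ m) (x c : ℝ) (hx0 : 0 < x) (hx1 : x < 1) (hc : 0 < c) :
    Summable (dblT m x c) := by
  rw [← (finTwoArrowEquiv ℤ).summable_iff]
  apply EisensteinSeries.summable_of_isBigO_rpow_norm (a := ((m + 1 : ℕ) : ℝ))
  · have : (2:ℝ) ≤ m := by exact_mod_cast hm
    push_cast; linarith
  set d := min (1 - x) c with hd
  have hdpos : 0 < d := lt_min (by linarith) hc
  apply IsBigO.of_bound ((d ^ (m+1))⁻¹)
  have h0 : ∀ᶠ v : Fin 2 → ℤ in cofinite, v ≠ 0 := by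
    simp [eventually_cofinite]
  filter_upwards [h0] with v hv
  have hvpos : 0 < ‖v‖ := norm_pos_iff.mpr hv
  have key : d * ‖v‖ ≤ ‖(x:ℂ) + v 0 + v 1 * (c * Complex.I)‖ := by
    have hre := Complex.abs_re_le_norm ((x:ℂ) + v 0 + v 1 * (c * Complex.I))
    have him := Complex.abs_im_le_norm ((x:ℂ) + v 0 + v 1 * (c * Complex.I))
    simp at hre him
    have h1 : d * |(v 0 : ℝ)| ≤ ‖(x:ℂ) + v 0 + v 1 * (c * Complex.I)‖ :=
      le_trans (le_trans (mul_le_mul_of_nonneg_right (min_le_left _ _) (abs_nonneg _))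
        (int_abs_bound x hx0 hx1 (v 0))) hre
    have h2 : d * |(v 1 : ℝ)| ≤ ‖(x:ℂ) + v 0 + v 1 * (c * Complex.I)‖ := by
      refine le_trans (mul_le_mul_of_nonneg_right (min_le_right (1 - x) c) (abs_nonneg _)) ?_
      rw [abs_of_pos hc] at him
      linarith
    have h3 : ‖v‖ = max |(v 0 : ℝ)| |(v 1 : ℝ)| := by
      rw [EisensteinSeries.norm_eq_max_natAbs]
      push_cast [Nat.cast_natAbs]
      rfl
    rw [h3]
    rcases max_cases |(v 0 : ℝ)| |(v 1 : ℝ)| with h | h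
    · rw [h.1]; exact h1
    · rw [h.1]; exact h2
  have hT : (dblT m x c ∘ finTwoArrowEquiv ℤ) v = 1 / ((x:ℂ) + v 0 + v 1 * (c * Complex.I)) ^ (m + 1) := rfl
  rw [hT, norm_div, norm_pow, norm_one, Real.rpow_natCast, norm_inv, norm_pow, norm_norm,
    ← mul_inv, ← mul_pow, one_div]
  gcongr

/-- Lipschitz formula, rows. -/
lemma row_sum (m : ℕ) (hm : 2 ≤ m) (y t : ℝ) (hy : 0 < y) (ht : 0 < t) :
    ∑' n : ℤ, 1 / ((y:ℂ) + n * ((2 * π / t : ℝ) * Complex.I)) ^ (m + 1) =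
      ((t ^ (m + 1) / (m.factorial : ℝ) * ∑' k : ℕ, (k:ℝ) ^ m * Real.exp (-(k * t * y)) : ℝ) : ℂ) := by
  have hzim : 0 < ((Complex.I * (t * y / (2 * π) : ℝ)) : ℂ).im := by
    rw [Complex.I_mul_im, Complex.ofReal_re]; positivity
  have h := EisensteinSeries.qExpansion_identity (k := m) (by omega) ⟨_, hzim⟩
  simp only at h
  have hpi : (π:ℂ) ≠ 0 := by exact_mod_cast pi_ne_zero
  have htc : (t:ℂ) ≠ 0 := by exact_mod_cast ht.ne'
  have e1 : ∀ n : ℤ, 1 / ((y:ℂ) + ((-n : ℤ) : ℂ) * ((2 * π / t : ℝ) * Complex.I)) ^ (m + 1) =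
      ((t:ℂ) ^ (m+1) / (-2 * π * Complex.I) ^ (m+1)) * (1 / ((Complex.I * (t * y / (2 * π) : ℝ)) + n) ^ (m + 1)) := by
    intro n
    have : (y:ℂ) + ((-n : ℤ) : ℂ) * ((2 * π / t : ℝ) * Complex.I) =
        (-2 * π * Complex.I) / t * ((Complex.I * (t * y / (2 * π) : ℝ)) + n) := by
      push_cast
      field_simp
      ring_nf
      simp only [Complex.I_sq]
      ring
    rw [this, mul_pow, div_pow, one_div, one_div, mul_inv, inv_div]
  rw [← (Equiv.neg ℤ).tsum_eq]
  simp only [Equiv.neg_apply]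
  simp_rw [e1]
  rw [tsum_mul_left, h]
  push_cast
  have e2 : ∀ k : ℕ, Complex.exp (2 * π * Complex.I * (Complex.I * (t * y / (2 * π)))) ^ k =
      Complex.exp (-(k * t * y)) := by
    intro k
    rw [← Complex.exp_nat_mul]
    congr 1
    field_simp
    rw [Complex.I_sq]
    ring
  simp_rw [e2]
  have hI : (-2 * π * Complex.I) ≠ 0 := by simp [hpi]
  generalize ∑' k : ℕ, (k:ℂ) ^ m * Complex.exp (-(k * t * y)) = A
  field_simp

lemma summable_pow_exp (m : ℕ) (a : ℝ) (ha : 0 < a) :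
    Summable fun k : ℕ => (k:ℝ) ^ m * Real.exp (-(k * a)) := by
  have := summable_pow_mul_geometric_of_norm_lt_one (R := ℝ) m (r := Real.exp (-a))
    (by rw [Real.norm_eq_abs, abs_of_pos (Real.exp_pos _)]; simpa using ha)
  refine this.congr fun k => ?_
  rw [← Real.exp_nat_mul]
  congr 2
  ring

lemma double_exp (m : ℕ) (hm : 2 ≤ m) (y t : ℝ) (hy : 0 < y) (ht : 0 < t) :
    ∑' j : ℕ, ∑' k : ℕ, (k:ℝ) ^ m * Real.exp (-(k * t * (y + j))) =
      ∑' k : ℕ, ((k:ℝ) + 1) ^ m * Real.exp (-((k + 1) * t * y)) / (1 - Real.exp (-((k + 1) * t))) := by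
  set F : ℕ → ℕ → ℝ := fun k j => ((k:ℝ) + 1) ^ m * Real.exp (-((k + 1) * t * (y + j))) with hF
  have hr : ∀ k : ℕ, Real.exp (-(((k:ℝ) + 1) * t)) < 1 := by
    intro k
    rw [Real.exp_lt_one_iff]
    have : 0 < ((k:ℝ) + 1) * t := by positivity
    linarith
  have hgeo : ∀ k : ℕ, HasSum (F k)
      (((k:ℝ) + 1) ^ m * Real.exp (-((k + 1) * t * y)) / (1 - Real.exp (-((k + 1) * t)))) := by
    intro k
    have h := (hasSum_geometric_of_lt_one (Real.exp_pos _).le (hr k)).mul_left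
      (((k:ℝ) + 1) ^ m * Real.exp (-((k + 1) * t * y)))
    rw [← div_eq_mul_inv] at h
    convert! h using 2 with j
    rw [hF]
    simp only
    rw [mul_assoc (((k:ℝ) + 1) ^ m), ← Real.exp_nat_mul, ← Real.exp_add]
    congr 2
    ring
  have hA : Summable fun k : ℕ => ((k:ℝ) + 1) ^ m * Real.exp (-((k + 1) * t * y)) := by
    have := (summable_nat_add_iff 1).mpr (summable_pow_exp m (t * y) (by positivity))
    refine this.congr fun k => ?_
    push_cast
    rw [mul_assoc]
  have hsum : Summable (Function.uncurry F) := by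
    rw [summable_prod_of_nonneg (fun p => by simp only [Function.uncurry, hF]; positivity)]
    refine ⟨fun k => (hgeo k).summable, ?_⟩
    have : (fun k => ∑' j, Function.uncurry F (k, j)) = fun k : ℕ =>
      (((k:ℝ) + 1) ^ m * Real.exp (-((k + 1) * t * y)) / (1 - Real.exp (-((k + 1) * t)))) := by
      funext k; exact (hgeo k).tsum_eq
    rw [this]
    refine Summable.of_nonneg_of_le (fun k => ?_) (fun k => ?_)
      (hA.mul_right ((1 - Real.exp (-t))⁻¹))
    · have := hr k
      exact div_nonneg (by positivity) (by linarith)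
    · rw [div_eq_mul_inv]
      have h1 : Real.exp (-(((k:ℝ) + 1) * t)) ≤ Real.exp (-t) := by
        rw [Real.exp_le_exp]
        have : 0 ≤ (k:ℝ) * t := by positivity
        linarith
      have h2 := hr 0
      simp at h2
      have h3 : 0 < 1 - Real.exp (-t) := by simpa using ht
      gcongr
  have e : ∀ j : ℕ, ∑' k : ℕ, (k:ℝ) ^ m * Real.exp (-(k * t * (y + j))) = ∑' k : ℕ, F k j := by
    intro j
    have hs : Summable fun k : ℕ => (k:ℝ) ^ m * Real.exp (-(k * t * (y + j))) := by
      refine (summable_pow_exp m (t * (y + j)) (by positivity)).congr fun k => ?_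
      rw [mul_assoc]
    rw [hs.tsum_eq_zero_add]
    have : m ≠ 0 := by omega
    simp [this, hF]
  simp_rw [e]
  rw [Summable.tsum_comm hsum]
  exact tsum_congr fun k => (hgeo k).tsum_eq

lemma qPolygamma_exp (m : ℕ) (hm : 2 ≤ m) (y t : ℝ) (hy : 0 < y) (ht : 0 < t) :
    qPolygamma (Real.exp (-t)) m y = (-1) ^ (m+1) * (m.factorial : ℝ) *
      ∑' j : ℕ, (t ^ (m + 1) / (m.factorial : ℝ) * ∑' k : ℕ, (k:ℝ) ^ m * Real.exp (-(k * t * (y + j)))) := by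
  rw [tsum_mul_left, double_exp m hm y t hy ht, qPolygamma, Real.log_exp, neg_pow]
  have hf : (m.factorial : ℝ) ≠ 0 := by positivity
  have : ∀ k : ℕ, ((k : ℝ) + 1) ^ m * Real.exp (-t) ^ (((k : ℝ) + 1) * y) / (1 - Real.exp (-t) ^ (k + 1))
    = ((k:ℝ) + 1) ^ m * Real.exp (-((k + 1) * t * y)) / (1 - Real.exp (-((k + 1) * t))) := by
    intro k
    rw [← Real.exp_mul, ← Real.exp_nat_mul]
    push_cast
    congr 3
    · ring
    · ring_nf
  simp_rw [this]
  generalize ∑' k : ℕ, ((k:ℝ) + 1) ^ m * Real.exp (-((k + 1) * t * y)) / (1 - Real.exp (-((k + 1) * t))) = A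
  field_simp

lemma qcomb (m : ℕ) (hm : 2 ≤ m) (x t : ℝ) (hx0 : 0 < x) (hx1 : x < 1) (ht : 0 < t) :
    ((qPolygamma (Real.exp (-t)) m x - (-1) ^ m * qPolygamma (Real.exp (-t)) m (1 - x) : ℝ) : ℂ) =
      (-1) ^ (m+1) * (m.factorial : ℂ) * ∑' p, dblT m x (2 * π / t) p := by
  have hS := dblT_summable m hm x (2 * π / t) hx0 hx1 (by positivity)
  have hrow := hS.prod
  rw [hS.tsum_prod, tsum_of_nat_of_neg_add_one (f := fun j : ℤ => ∑' n : ℤ, dblT m x (2 * π / t) (j, n))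
    (hrow.comp_injective Nat.cast_injective)
    (hrow.comp_injective (i := fun n : ℕ => (-((n:ℤ) + 1))) (fun a b h => by simpa using h))]
  have e1 : ∀ j : ℕ, ∑' n : ℤ, dblT m x (2 * π / t) ((j:ℤ), n) =
    ((t ^ (m + 1) / (m.factorial : ℝ) * ∑' k : ℕ, (k:ℝ) ^ m * Real.exp (-(k * t * (x + j))) : ℝ) : ℂ) := by
    intro j
    rw [← row_sum m hm (x + j) t (by positivity) ht]
    simp [dblT]
  have e2 : ∀ j : ℕ, ∑' n : ℤ, dblT m x (2 * π / t) (-((j:ℤ) + 1), n) = (-1) ^ (m+1) *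
    ((t ^ (m + 1) / (m.factorial : ℝ) * ∑' k : ℕ, (k:ℝ) ^ m * Real.exp (-(k * t * (1 - x + j))) : ℝ) : ℂ) := by
    intro j
    have hj : (0:ℝ) ≤ j := by positivity
    rw [← row_sum m hm (1 - x + j) t (by linarith) ht, ← (Equiv.neg ℤ).tsum_eq, ← tsum_mul_left]
    refine tsum_congr fun n => ?_
    have hsgn : ((-1:ℂ)) ^ (m+1) * (-1) ^ (m+1) = 1 := by
      rw [← mul_pow]; simp
    have : ((x:ℂ) + ((-((j:ℤ) + 1) : ℤ):ℂ) + ((-n : ℤ):ℂ) * ((2 * π / t : ℝ) * Complex.I)) =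
      (-1) * (((1 - x + j : ℝ) : ℂ) + n * ((2 * π / t : ℝ) * Complex.I)) := by
      push_cast; ring
    simp only [dblT, Equiv.neg_apply]
    rw [this, mul_pow, one_div, mul_inv, one_div, ← inv_pow]
    norm_num
  simp_rw [e1, e2]
  rw [tsum_mul_left, ← Complex.ofReal_tsum, ← Complex.ofReal_tsum,
    qPolygamma_exp m hm x t hx0 ht, qPolygamma_exp m hm (1 - x) t (by linarith) ht]
  push_cast
  rw [pow_succ]
  ring

lemma col_bound_pos (m N : ℕ) (hm : 2 ≤ m) (z : ℂ) (hz : 0 < z.im) :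
    ‖∑' n : ℤ, 1 / (z + n) ^ (m + 1)‖ ≤ (2 * π) ^ (m + 1) / (m.factorial : ℝ) *
      (∑' k : ℕ, 1 / (k:ℝ) ^ (N + 2)) * ((m + 2 + N).factorial : ℝ) * (1 / z.im ^ (m + 2 + N)) := by
  have h := EisensteinSeries.qExpansion_identity (k := m) (by omega) ⟨z, hz⟩
  simp only at h
  rw [h, norm_mul, norm_div, norm_pow]
  have e1 : ‖(-2 * π * Complex.I)‖ = 2 * π := by simp [abs_of_pos pi_pos]
  rw [e1, Complex.norm_natCast]
  have hb : HasSum (fun k : ℕ => ((m + 2 + N).factorial : ℝ) * (1 / z.im ^ (m + 2 + N)) * (1 / (k:ℝ) ^ (N + 2)))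
      (((m + 2 + N).factorial : ℝ) * (1 / z.im ^ (m + 2 + N)) * ∑' k : ℕ, 1 / (k:ℝ) ^ (N + 2)) :=
    (Real.summable_one_div_nat_pow.mpr (by omega)).hasSum.mul_left _
  have h2 := tsum_of_norm_bounded hb (f := fun n : ℕ => (n:ℂ) ^ m * Complex.exp (2 * π * Complex.I * z) ^ n) ?_
  · calc _ ≤ (2 * π) ^ (m + 1) / (m.factorial : ℝ) * (((m + 2 + N).factorial : ℝ) * (1 / z.im ^ (m + 2 + N)) * ∑' k : ℕ, 1 / (k:ℝ) ^ (N + 2)) := by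
          gcongr
      _ = _ := by ring
  · intro k
    rcases Nat.eq_zero_or_pos k with rfl | hk
    · have : m ≠ 0 := by omega
      simp [this]
    have hk' : (0:ℝ) < k := by exact_mod_cast hk
    rw [norm_mul, norm_pow, norm_pow, Complex.norm_exp, Complex.norm_natCast]
    have e2 : (2 * π * Complex.I * z).re = -(2 * π * z.im) := by simp
    rw [e2, ← Real.exp_nat_mul]
    have hs : 0 < (k:ℝ) * z.im := by positivity
    have h3 : Real.exp (k * -(2 * π * z.im)) ≤ Real.exp (-(k * z.im)) := by
      rw [Real.exp_le_exp]
      nlinarith [pi_gt_three]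
    have h4 := Real.pow_div_factorial_le_exp (x := k * z.im) hs.le (m + 2 + N)
    have h5 : Real.exp (-(k * z.im)) ≤ ((m + 2 + N).factorial : ℝ) / (k * z.im) ^ (m + 2 + N) := by
      rw [Real.exp_neg, ← inv_div]
      gcongr
    calc _ ≤ (k:ℝ) ^ m * (((m + 2 + N).factorial : ℝ) / (k * z.im) ^ (m + 2 + N)) := by
            gcongr; exact h3.trans h5
      _ = _ := by
        rw [mul_pow, show m + 2 + N = m + (N + 2) by omega, pow_add (k:ℝ)]
        field_simp

lemma col_bound (m N : ℕ) (hm : 2 ≤ m) (z : ℂ) (hz : z.im ≠ 0) :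
    ‖∑' n : ℤ, 1 / (z + n) ^ (m + 1)‖ ≤ (2 * π) ^ (m + 1) / (m.factorial : ℝ) *
      (∑' k : ℕ, 1 / (k:ℝ) ^ (N + 2)) * ((m + 2 + N).factorial : ℝ) * (1 / |z.im| ^ (m + 2 + N)) := by
  rcases lt_or_gt_of_ne hz with h | h
  · have := col_bound_pos m N hm (-z) (by simpa using h)
    rw [abs_of_neg h]
    rw [Complex.neg_im] at this
    refine le_of_eq_of_le ?_ this
    rw [← (Equiv.neg ℤ).tsum_eq]
    have e : ∀ n : ℤ, 1 / (z + ((-n : ℤ) : ℂ)) ^ (m+1) = (-1) ^ (m+1) * (1 / (-z + n) ^ (m+1)) := by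
      intro n
      have : z + ((-n : ℤ) : ℂ) = (-1) * (-z + n) := by push_cast; ring
      rw [this, mul_pow, one_div, mul_inv, one_div, ← inv_pow]
      norm_num
    simp only [Equiv.neg_apply]
    simp_rw [e]
    rw [tsum_mul_left, norm_mul]
    simp
  · rw [abs_of_pos h]
    exact col_bound_pos m N hm z h

lemma dbl_error (m N : ℕ) (hm : 2 ≤ m) (x : ℝ) (hx0 : 0 < x) (hx1 : x < 1) :
    ∃ C : ℝ, 0 ≤ C ∧ ∀ c : ℝ, 0 < c →
      ‖∑' p, dblT m x c p - ∑' n : ℤ, 1 / ((x:ℂ) + n) ^ (m + 1)‖ ≤ C * (1 / c ^ (m + 2 + N)) := by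
  set K := (2 * π) ^ (m + 1) / (m.factorial : ℝ) *
      (∑' k : ℕ, 1 / (k:ℝ) ^ (N + 2)) * ((m + 2 + N).factorial : ℝ) with hK
  have hK0 : 0 ≤ K := by
    have : 0 ≤ ∑' k : ℕ, 1 / (k:ℝ) ^ (N + 2) := tsum_nonneg fun k => by positivity
    positivity
  have hint : Summable fun n : ℤ => 1 / |(n:ℝ)| ^ (m + 2 + N) := by
    have := (Real.summable_one_div_int_pow (p := m + 2 + N)).mpr (by omega)
    simpa using this.norm
  refine ⟨K * ∑' n : ℤ, 1 / |(n:ℝ)| ^ (m + 2 + N), mul_nonneg hK0 (tsum_nonneg fun k => by positivity),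
    fun c hc => ?_⟩
  have hS := dblT_summable m hm x c hx0 hx1 hc
  have hS' : Summable fun p : ℤ × ℤ => dblT m x c p.swap := (Equiv.prodComm ℤ ℤ).summable_iff.mpr hS
  rw [← (Equiv.prodComm ℤ ℤ).tsum_eq]
  simp only [Equiv.prodComm_apply]
  rw [hS'.tsum_prod, hS'.prod.tsum_eq_add_tsum_ite 0]
  have e0 : ∑' j : ℤ, dblT m x c (Prod.swap ((0:ℤ), j)) = ∑' n : ℤ, 1 / ((x:ℂ) + n) ^ (m + 1) := by
    simp [dblT]
  rw [e0, add_sub_cancel_left]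
  have hb := (hint.hasSum.mul_left (K * (1 / c ^ (m + 2 + N))))
  refine (tsum_of_norm_bounded hb fun n => ?_).trans_eq (by ring)
  by_cases hn : n = 0
  · simp only [hn, if_true, norm_zero]
    positivity
  · rw [if_neg hn]
    have hn' : (n:ℝ) ≠ 0 := by exact_mod_cast hn
    have := col_bound m N hm ((x:ℂ) + n * (c * Complex.I)) (by simp [hn', hc.ne'])
    have e : ∑' j : ℤ, dblT m x c (Prod.swap (n, j)) =
        ∑' j : ℤ, 1 / ((x:ℂ) + n * (c * Complex.I) + j) ^ (m+1) := by
      refine tsum_congr fun j => ?_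
      simp only [dblT, Prod.swap]
      rw [add_right_comm]
    rw [e]
    refine this.trans_eq ?_
    have e3 : ((x:ℂ) + n * (c * Complex.I)).im = n * c := by simp
    rw [e3, abs_mul, abs_of_pos hc, ← hK, mul_pow]
    field_simp

/-- Asymptotic reflection formula for the q-polygamma functions with
`m ≥ 2`: for `0 < x < 1` and every `n : ℕ`,
`ψ_q^{(m)}(x) − (−1)^m ψ_q^{(m)}(1-x) − (ψ^{(m)}(x) − (−1)^m ψ^{(m)}(1-x)) = O((1-q)^n)`
as `q → 1⁻`. -/
theorem qPolygamma_reflection (m : ℕ) (hm : 2 ≤ m)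
    (x : ℝ) (hx0 : 0 < x) (hx1 : x < 1) (n : ℕ) :
    (fun q : ℝ =>
        qPolygamma q m x - (-1) ^ m * qPolygamma q m (1 - x) -
          (polygamma m x - (-1) ^ m * polygamma m (1 - x)))
      =O[𝓝[Set.Ioo (0 : ℝ) 1] 1] fun q : ℝ => (1 - q) ^ n := by
  obtain ⟨C, hC, hb⟩ := dbl_error m n hm x hx0 hx1
  apply IsBigO.of_bound ((m.factorial : ℝ) * (C * 2 ^ (m + 2 + n)))
  have hq2 : ∀ᶠ q : ℝ in 𝓝[Set.Ioo (0:ℝ) 1] 1, 1 / 2 < q :=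
    nhdsWithin_le_nhds (lt_mem_nhds (by norm_num))
  filter_upwards [self_mem_nhdsWithin, hq2] with q hq hqh
  obtain ⟨t, ht⟩ : ∃ t, t = -Real.log q := ⟨_, rfl⟩
  have htpos : 0 < t := by
    have := Real.log_neg hq.1 hq.2
    linarith
  have hqt : q = Real.exp (-t) := by rw [ht, neg_neg, Real.exp_log hq.1]
  have htle : t ≤ 2 * (1 - q) := by
    have h1 := Real.one_sub_inv_le_log_of_pos hq.1
    have h2 : q⁻¹ - 1 ≤ 2 * (1 - q) := by
      have : q⁻¹ - 1 = (1 - q) / q := by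
        have := hq.1.ne'
        field_simp
      rw [this, div_le_iff₀ hq.1]
      nlinarith [hq.2]
    linarith
  have hcomb : ((qPolygamma q m x - (-1) ^ m * qPolygamma q m (1 - x) -
          (polygamma m x - (-1) ^ m * polygamma m (1 - x)) : ℝ) : ℂ) =
      (-1) ^ (m+1) * (m.factorial : ℂ) *
        (∑' p, dblT m x (2 * π / t) p - ∑' n : ℤ, 1 / ((x:ℂ) + n) ^ (m + 1)) := by
    rw [Complex.ofReal_sub, hqt, qcomb m hm x t hx0 hx1 htpos, polygamma_comb m hm x hx0 hx1,
      sum_real]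
    push_cast
    ring
  rw [← Complex.norm_real, hcomb, norm_mul, norm_mul, norm_pow, norm_neg, norm_one, one_pow, one_mul,
    Complex.norm_natCast, mul_assoc (m.factorial : ℝ)]
  have h1q : 0 ≤ 1 - q := by linarith [hq.2]
  rw [Real.norm_of_nonneg (pow_nonneg h1q n)]
  refine mul_le_mul_of_nonneg_left ((hb _ (by positivity)).trans ?_) (by positivity)
  rw [mul_assoc]
  refine mul_le_mul_of_nonneg_left ?_ hC
  have e : 1 / (2 * π / t) ^ (m + 2 + n) = (t / (2 * π)) ^ (m + 2 + n) := by
    rw [one_div, ← inv_pow, inv_div]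
  have h3 : t / (2 * π) ≤ t := div_le_self htpos.le (by linarith [pi_gt_three])
  calc 1 / (2 * π / t) ^ (m + 2 + n) = (t / (2 * π)) ^ (m + 2 + n) := e
    _ ≤ (2 * (1 - q)) ^ (m + 2 + n) := by
      gcongr
      exact h3.trans htle
    _ = 2 ^ (m + 2 + n) * (1 - q) ^ (m + 2 + n) := mul_pow _ _ _
    _ ≤ 2 ^ (m + 2 + n) * (1 - q) ^ n := by
      refine mul_le_mul_of_nonneg_left ?_ (by positivity)
      exact pow_le_pow_of_le_one h1q (by linarith [hq.1]) (by omega)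
end

section
/- Fix z ∈ ℝ with z mod π ≠ π/2, and let z_π = z mod π ∈ [0, π). Then, as q → 1⁻ (with q ∈ (0,1)), the ratio ϑ₂(z,q) / [ √(π/log(1/q)) · ( exp(z_π²/log q) − exp((π − z_π)²/log q) ) · (−1)^⌊z/π⌋ ] tends to 1. -/
open Filter Topology Real Complex

/-- The Jacobi theta function `ϑ₂(z,q) = ∑_{n ∈ ℤ} q^{(n+1/2)²} e^{i(2n+1)z}`. -/
noncomputable def jacobiTheta2 (z q : ℝ) : ℂ :=
  ∑' n : ℤ, ((q ^ (((n : ℝ) + 1 / 2) ^ 2) : ℝ) : ℂ) *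
    Complex.exp (Complex.I * (2 * (n : ℂ) + 1) * (z : ℂ))

lemma theta_transform (z q : ℝ) (hq : q ∈ Set.Ioo (0 : ℝ) 1) :
    jacobiTheta2 z q = ((Real.sqrt (Real.pi / Real.log (1 / q)) *
      ∑' n : ℤ, (-1 : ℝ) ^ n * Real.exp ((Real.pi * n - z) ^ 2 / Real.log q) : ℝ) : ℂ) := by
  obtain ⟨h0, h1⟩ := hq
  have hlog : Real.log q < 0 := Real.log_neg h0 h1
  set L : ℝ := - Real.log q with hL
  have hLpos : 0 < L := by linarith
  have hlq : Real.log q = -L := by simp [hL]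
  have hl1 : Real.log (1 / q) = L := by simp [hL]
  have hpi := Real.pi_pos
  have hpic : (Real.pi : ℂ) ≠ 0 := by exact_mod_cast hpi.ne'
  have hLc : (L : ℂ) ≠ 0 := by exact_mod_cast hLpos.ne'
  set a : ℝ := L / Real.pi with ha
  have hapos : 0 < a := by positivity
  have key := Complex.tsum_exp_neg_quadratic (a := (a : ℂ)) (by simpa using hapos)
    (-(a : ℂ) / 2 + Complex.I * z / Real.pi)
  have hsq : (1 : ℂ) / (a : ℂ) ^ (1 / 2 : ℂ) = ((Real.sqrt (Real.pi / L) : ℝ) : ℂ) := by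
    have : (Real.sqrt (Real.pi / L) : ℝ) = 1 / a ^ (1 / 2 : ℝ) := by
      rw [← Real.sqrt_eq_rpow, ha, one_div, ← Real.sqrt_inv, inv_div]
    rw [this]
    push_cast
    rw [Complex.ofReal_cpow hapos.le]
    norm_num
  rw [hsq] at key
  have hac : (a : ℂ) = L / Real.pi := by simp [ha]
  unfold jacobiTheta2
  rw [hl1, hlq]
  have e1 : ∀ n : ℤ, ((q ^ (((n : ℝ) + 1 / 2) ^ 2) : ℝ) : ℂ) *
      Complex.exp (Complex.I * (2 * (n : ℂ) + 1) * (z : ℂ)) =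
      Complex.exp (-L / 4 + Complex.I * z) * Complex.exp (-Real.pi * a * n ^ 2 +
        2 * Real.pi * (-(a : ℂ) / 2 + Complex.I * z / Real.pi) * n) := by
    intro n
    rw [Real.rpow_def_of_pos h0, hlq]
    push_cast
    rw [← Complex.exp_add, ← Complex.exp_add, hac]
    congr 1
    field_simp
    ring
  simp_rw [e1]
  rw [tsum_mul_left, key]
  push_cast
  rw [mul_left_comm, ← tsum_mul_left]
  congr 1
  apply tsum_congr
  intro n
  have e2 : (-1 : ℂ) ^ n = Complex.exp (n * (Real.pi * Complex.I)) := by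
    rw [Complex.exp_int_mul, Complex.exp_pi_mul_I]
  rw [e2, ← Complex.exp_add, ← Complex.exp_add, hac]
  congr 1
  field_simp
  ring_nf
  simp only [Complex.I_sq, show Complex.I ^ 3 = -Complex.I from Complex.I_pow_three, Complex.I_pow_four]
  ring

lemma theta_shift (z w L : ℝ) (m : ℤ) (h : w = z - Real.pi * m) :
    ∑' n : ℤ, (-1 : ℝ) ^ n * Real.exp ((Real.pi * n - z) ^ 2 / L) =
    (-1 : ℝ) ^ m * ∑' n : ℤ, (-1 : ℝ) ^ n * Real.exp ((Real.pi * n - w) ^ 2 / L) := by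
  rw [← tsum_mul_left, ← (Equiv.addRight m).tsum_eq]
  apply tsum_congr
  intro n
  simp only [Equiv.coe_addRight]
  rw [zpow_add₀ (by norm_num), h]
  push_cast
  rw [show Real.pi * (n + m) - z = Real.pi * n - (z - Real.pi * m) by ring]
  ring

lemma tendsto_term (c : ℝ) (hc : 0 < c) :
    Tendsto (fun q : ℝ => Real.exp (c / Real.log q)) (𝓝[Set.Ioo (0 : ℝ) 1] 1) (𝓝 0) := by
  apply Real.tendsto_exp_atBot.comp
  have h1 : Tendsto Real.log (𝓝[Set.Ioo (0 : ℝ) 1] 1) (𝓝[<] 0) := by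
    apply tendsto_nhdsWithin_of_tendsto_nhds_of_eventually_within
    · have := (Real.continuousAt_log (x := 1) one_ne_zero).tendsto
      rw [Real.log_one] at this
      exact this.mono_left nhdsWithin_le_nhds
    · filter_upwards [self_mem_nhdsWithin] with q hq
      exact Real.log_neg hq.1 hq.2
  have := (tendsto_inv_nhdsLT_zero.comp h1).const_mul_atBot hc
  simpa [div_eq_mul_inv, Function.comp_def] using this

lemma main_lim (w : ℝ) (k0 : ℤ)
    (hk : ∀ k : ℤ, k ≠ k0 → (Real.pi * k0 - w) ^ 2 < (Real.pi * k - w) ^ 2) (s : ℤ → ℝ)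
    (hs : ∀ k, |s k| ≤ 1) :
    Tendsto (fun q : ℝ => ∑' k : ℤ, s k *
      Real.exp (((Real.pi * k - w) ^ 2 - (Real.pi * k0 - w) ^ 2) / Real.log q))
      (𝓝[Set.Ioo (0 : ℝ) 1] 1) (𝓝 (s k0)) := by
  have hle : ∀ k : ℤ, 0 ≤ (Real.pi * k - w) ^ 2 - (Real.pi * k0 - w) ^ 2 := by
    intro k
    by_cases h : k = k0
    · simp [h]
    · linarith [hk k h]
  have hsum : Summable (fun k : ℤ =>
      Real.exp (-((Real.pi * k - w) ^ 2 - (Real.pi * k0 - w) ^ 2))) := by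
    have := (HurwitzKernelBounds.summable_f_int 0 (-w / Real.pi) Real.pi_pos).mul_left
      (Real.exp ((Real.pi * k0 - w) ^ 2))
    refine this.congr fun k => ?_
    simp only [HurwitzKernelBounds.f_int, pow_zero, one_mul]
    rw [← Real.exp_add]
    congr 1
    have := Real.pi_pos.ne'
    field_simp
    ring
  have hev : ∀ᶠ q : ℝ in 𝓝[Set.Ioo (0 : ℝ) 1] 1, -1 < Real.log q ∧ Real.log q < 0 := by
    have h1 : ∀ᶠ q : ℝ in 𝓝[Set.Ioo (0 : ℝ) 1] 1, Real.exp (-1) < q :=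
      nhdsWithin_le_nhds (lt_mem_nhds (by simp))
    filter_upwards [self_mem_nhdsWithin, h1] with q hq hq1
    exact ⟨(Real.lt_log_iff_exp_lt hq.1).2 hq1, Real.log_neg hq.1 hq.2⟩
  have := tendsto_tsum_of_dominated_convergence (𝓕 := 𝓝[Set.Ioo (0 : ℝ) 1] (1 : ℝ))
    (f := fun (q : ℝ) (k : ℤ) => s k *
      Real.exp (((Real.pi * k - w) ^ 2 - (Real.pi * k0 - w) ^ 2) / Real.log q))
    (g := fun k => if k = k0 then s k0 else 0) hsum ?_ ?_
  · simpa using this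
  · intro k
    by_cases h : k = k0
    · simp [h]
    · simp only [h, if_false]
      simpa using (tendsto_term _ (sub_pos.2 (hk k h))).const_mul (s k)
  · filter_upwards [hev] with q hq k
    rw [norm_mul, Real.norm_eq_abs, Real.norm_eq_abs, Real.abs_exp]
    refine (mul_le_of_le_one_left (Real.exp_pos _).le (hs k)).trans ?_
    apply Real.exp_le_exp.2
    rw [div_le_iff_of_neg hq.2]
    nlinarith [hle k, hq.1]

theorem ratio_lim (w : ℝ) (h0 : 0 ≤ w) (h1 : w < Real.pi) (hz : w ≠ Real.pi / 2) :
    Tendsto (fun q : ℝ => (∑' n : ℤ, (-1 : ℝ) ^ n * Real.exp ((Real.pi * n - w) ^ 2 / Real.log q)) /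
      (Real.exp (w ^ 2 / Real.log q) - Real.exp ((Real.pi - w) ^ 2 / Real.log q)))
      (𝓝[Set.Ioo (0 : ℝ) 1] 1) (𝓝 1) := by
  have hpi := Real.pi_pos
  obtain ⟨k0, hk01, hk⟩ : ∃ k0 : ℤ, (k0 = 0 ∨ k0 = 1) ∧
      ∀ k : ℤ, k ≠ k0 → (Real.pi * k0 - w) ^ 2 < (Real.pi * k - w) ^ 2 := by
    rcases lt_or_gt_of_ne hz with h | h
    · refine ⟨0, Or.inl rfl, fun k hk => ?_⟩
      rcases lt_or_gt_of_ne hk with h' | h'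
      · have : (k : ℝ) ≤ -1 := by exact_mod_cast (show k ≤ -1 by omega)
        have : Real.pi * k ≤ -Real.pi := by nlinarith
        push_cast
        nlinarith
      · have : (1 : ℝ) ≤ k := by exact_mod_cast (show 1 ≤ k by omega)
        have : Real.pi ≤ Real.pi * k := by nlinarith
        push_cast
        nlinarith
    · refine ⟨1, Or.inr rfl, fun k hk => ?_⟩
      rcases lt_or_gt_of_ne hk with h' | h'
      · have : (k : ℝ) ≤ 0 := by exact_mod_cast (show k ≤ 0 by omega)
        have : Real.pi * k ≤ 0 := by nlinarith
        push_cast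
        nlinarith
      · have : (2 : ℝ) ≤ k := by exact_mod_cast (show 2 ≤ k by omega)
        have : Real.pi * 2 ≤ Real.pi * k := by nlinarith
        push_cast
        nlinarith
  have habs : ∀ k : ℤ, |(-1 : ℝ) ^ k| ≤ 1 := by
    intro k
    simp [abs_zpow]
  have A := main_lim w k0 hk (fun k => (-1 : ℝ) ^ k) habs
  have B := main_lim w k0 hk (fun k => if k ∈ ({0, 1} : Finset ℤ) then (-1 : ℝ) ^ k else 0) (by
    intro k
    split_ifs
    · exact habs k
    · simp)
  have hmem : k0 ∈ ({0, 1} : Finset ℤ) := by simpa using hk01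
  simp only [hmem, if_true] at B
  have hne : (-1 : ℝ) ^ k0 ≠ 0 := zpow_ne_zero _ (by norm_num)
  have C := A.div B hne
  rw [div_self hne] at C
  refine C.congr fun q => ?_
  have hB : (∑' k : ℤ, (if k ∈ ({0, 1} : Finset ℤ) then (-1 : ℝ) ^ k else 0) *
      Real.exp (((Real.pi * k - w) ^ 2 - (Real.pi * k0 - w) ^ 2) / Real.log q)) =
      Real.exp (-(Real.pi * k0 - w) ^ 2 / Real.log q) *
      (Real.exp (w ^ 2 / Real.log q) - Real.exp ((Real.pi - w) ^ 2 / Real.log q)) := by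
    rw [tsum_eq_sum (s := ({0, 1} : Finset ℤ)) (fun k hk => by rw [if_neg hk, zero_mul])]
    rw [mul_sub, ← Real.exp_add, ← Real.exp_add]
    simp
    rw [← sub_eq_add_neg]
    congr 2 <;> ring
  have hA : (∑' k : ℤ, (-1 : ℝ) ^ k *
      Real.exp (((Real.pi * k - w) ^ 2 - (Real.pi * k0 - w) ^ 2) / Real.log q)) =
      Real.exp (-(Real.pi * k0 - w) ^ 2 / Real.log q) *
      ∑' n : ℤ, (-1 : ℝ) ^ n * Real.exp ((Real.pi * n - w) ^ 2 / Real.log q) := by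
    rw [← tsum_mul_left]
    apply tsum_congr
    intro k
    rw [mul_left_comm, ← Real.exp_add]
    congr 2
    ring
  rw [Pi.div_apply, hA, hB, mul_div_mul_left _ _ (Real.exp_ne_zero _)]

/-- Asymptotic form of `ϑ₂` near `q = 1`: with `z_π = z mod π ≠ π/2`,
the ratio `ϑ₂(z,q) / (√(π/log(1/q)) (e^{z_π²/log q} − e^{(π-z_π)²/log q}) (−1)^⌊z/π⌋)`
tends to `1` as `q → 1⁻`. -/
theorem jacobiTheta2_asymptotic (z : ℝ) (zpi : ℝ)
    (hzpi : zpi = z - Real.pi * (⌊z / Real.pi⌋ : ℤ)) (hz : zpi ≠ Real.pi / 2) :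
    Tendsto (fun q : ℝ =>
        jacobiTheta2 z q /
          ((Real.sqrt (Real.pi / Real.log (1 / q)) *
              (Real.exp (zpi ^ 2 / Real.log q) -
                Real.exp ((Real.pi - zpi) ^ 2 / Real.log q)) *
              (-1 : ℝ) ^ ⌊z / Real.pi⌋ : ℝ) : ℂ))
      (𝓝[Set.Ioo (0 : ℝ) 1] 1) (𝓝 1) := by
  have hpi := Real.pi_pos
  have h0 : 0 ≤ zpi := by
    have := (le_div_iff₀ hpi).1 (Int.floor_le (z / Real.pi))
    linarith
  have h1 : zpi < Real.pi := by
    have := (div_lt_iff₀ hpi).1 (Int.lt_floor_add_one (z / Real.pi))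
    linarith
  have R := (Complex.continuous_ofReal.tendsto 1).comp (ratio_lim zpi h0 h1 hz)
  rw [Complex.ofReal_one] at R
  refine R.congr' ?_
  filter_upwards [self_mem_nhdsWithin] with q hq
  rw [theta_transform z q hq, theta_shift z zpi _ _ hzpi, ← Complex.ofReal_div,
    Function.comp_apply]
  congr 1
  have hs : Real.sqrt (Real.pi / Real.log (1 / q)) ≠ 0 := by
    have : 0 < Real.log (1 / q) := by
      have := Real.log_neg hq.1 hq.2
      simpa using this
    positivity
  have hm : (-1 : ℝ) ^ ⌊z / Real.pi⌋ ≠ 0 := zpow_ne_zero _ (by norm_num)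
  rw [← mul_assoc, mul_right_comm _ (_ - _), mul_div_mul_left _ _ (mul_ne_zero hs hm)]
end
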